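/- (Theorem 4.2: monotonicity of Algorithm 2.) Let x_0 ∈ ℝ^d and for k = 0, …, K−1 let x_{k+1} be any minimizer over x ∈ ℝ^d of the map x ↦ D_KL(φ_{x,τ}‖q_{x_k,τ}) (assumed to exist, with all the quantities D_KL(φ_{x,τ}‖q_{x_k,τ}), log ∫ e^f q_{x_k,τ}, and F^H_τ(x_k) finite). Then the heat-regularized loss decreases monotonically along the iterates: F^H_τ(x_k) ≤ F^H_τ(x_{k−1}) for all 1 ≤ k ≤ K. -/

import Mathlib

open MeasureTheory Real

/-- Gaussian density on `ℝ^d` with mean `x` and covariance `τ I`. -/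
noncomputable def phi (d : ℕ) (τ : ℝ) (x x' : EuclideanSpace ℝ (Fin d)) : ℝ :=
  (2 * π * τ) ^ (-(d : ℝ) / 2) * Real.exp (-‖x' - x‖ ^ 2 / (2 * τ))

/-- Kullback–Leibler divergence `∫ p log (p / q)` between densities on `ℝ^d`. -/
noncomputable def KL (d : ℕ) (p q : EuclideanSpace ℝ (Fin d) → ℝ) : ℝ :=
  ∫ y, p y * Real.log (p y / q y)

/-- Normalizing constant `Z_{x,τ} = ∫ exp (-f) φ_{x,τ}`. -/
noncomputable def Z (d : ℕ) (τ : ℝ) (f : EuclideanSpace ℝ (Fin d) → ℝ)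
    (x : EuclideanSpace ℝ (Fin d)) : ℝ :=
  ∫ x', Real.exp (-f x') * phi d τ x x'

/-- The density `q_{x,τ} = Z_{x,τ}⁻¹ exp (-f) φ_{x,τ}`. -/
noncomputable def qdens (d : ℕ) (τ : ℝ) (f : EuclideanSpace ℝ (Fin d) → ℝ)
    (x x' : EuclideanSpace ℝ (Fin d)) : ℝ :=
  (Z d τ f x)⁻¹ * (Real.exp (-f x') * phi d τ x x')

theorem phi_pos (d : ℕ) {τ : ℝ} (hτ : 0 < τ) (x z : EuclideanSpace ℝ (Fin d)) :
    0 < phi d τ x z := by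
  unfold phi
  positivity

theorem integrable_phi (d : ℕ) {τ : ℝ} (hτ : 0 < τ) (x : EuclideanSpace ℝ (Fin d)) :
    Integrable (phi d τ x) := by
  have h := (GaussianFourier.integrable_cexp_neg_mul_sq_norm_add (V := EuclideanSpace ℝ (Fin d))
    (b := ((1 / (2 * τ) : ℝ) : ℂ)) (by rw [Complex.ofReal_re]; positivity) 0 0).re
  refine ((h.comp_sub_right x).const_mul ((2 * π * τ) ^ (-(d : ℝ) / 2))).congr
    (Filter.Eventually.of_forall fun z => ?_)
  simp only [phi, inner_zero_left, Complex.ofReal_zero, mul_zero, add_zero]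
  have e : -((1 / (2 * τ) : ℝ) : ℂ) * (‖z - x‖ : ℂ) ^ 2 =
      ((-‖z - x‖ ^ 2 / (2 * τ) : ℝ) : ℂ) := by
    push_cast
    ring
  rw [e, ← Complex.ofReal_exp]
  rfl

theorem integral_phi_eq (d : ℕ) (τ : ℝ) (x y : EuclideanSpace ℝ (Fin d)) :
    ∫ z, phi d τ x z = ∫ z, phi d τ y z := by
  have h (x : EuclideanSpace ℝ (Fin d)) : ∫ z, phi d τ x z = ∫ z, phi d τ 0 z := by
    rw [← integral_sub_right_eq_self (phi d τ 0) x]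
    simp [phi]
  rw [h x, h y]

/-- The log-ratio of `phi d τ y` and `qdens d τ f x`, weighted by `phi d τ y`. -/
theorem phi_mul_log_div_qdens (d : ℕ) {τ : ℝ} (hτ : 0 < τ)
    (f : EuclideanSpace ℝ (Fin d) → ℝ) (x y z : EuclideanSpace ℝ (Fin d))
    (hZ : 0 < Z d τ f x) :
    phi d τ y z * Real.log (phi d τ y z / qdens d τ f x z) =
      f z * phi d τ y z + Real.log (Z d τ f x) * phi d τ y z +
        phi d τ y z * ((‖z - x‖ ^ 2 - ‖z - y‖ ^ 2) / (2 * τ)) := by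
  have hx := phi_pos d hτ x z
  have hy := phi_pos d hτ y z
  have hlog (w : EuclideanSpace ℝ (Fin d)) : Real.log (phi d τ w z) =
      Real.log ((2 * π * τ) ^ (-(d : ℝ) / 2)) + -‖z - w‖ ^ 2 / (2 * τ) := by
    rw [phi, Real.log_mul (by positivity) (Real.exp_ne_zero _), Real.log_exp]
  have hq : Real.log (qdens d τ f x z) =
      -Real.log (Z d τ f x) + (-f z + Real.log (phi d τ x z)) := by
    rw [qdens, Real.log_mul (by positivity) (by positivity), Real.log_inv,
      Real.log_mul (Real.exp_ne_zero _) hx.ne', Real.log_exp]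
  have hq0 : qdens d τ f x z ≠ 0 := by
    unfold qdens
    positivity
  rw [Real.log_div hy.ne' hq0, hq, hlog x, hlog y]
  ring

/-- The Kullback–Leibler divergence between two Gaussians of equal covariance is nonnegative. -/
theorem integral_phi_mul_sq_sub_sq_nonneg (d : ℕ) {τ : ℝ} (hτ : 0 < τ)
    (x y : EuclideanSpace ℝ (Fin d))
    (hint : Integrable fun z => phi d τ y z * ((‖z - x‖ ^ 2 - ‖z - y‖ ^ 2) / (2 * τ))) :
    0 ≤ ∫ z, phi d τ y z * ((‖z - x‖ ^ 2 - ‖z - y‖ ^ 2) / (2 * τ)) := by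
  set g : EuclideanSpace ℝ (Fin d) → ℝ :=
    fun z => phi d τ y z * ((‖z - x‖ ^ 2 - ‖z - y‖ ^ 2) / (2 * τ)) with hg
  have hrefl : ∫ z, g ((y + y) - z) = ∫ z, g z := integral_sub_left_eq_self g volume (y + y)
  have hsum : 0 ≤ ∫ z, (g z + g ((y + y) - z)) := by
    refine integral_nonneg fun z => ?_
    have e1 : y + y - z - y = -(z - y) := by abel
    have e2 : y + y - z - x = (y - x) - (z - y) := by abel
    have e3 : z - x = (y - x) + (z - y) := by abel
    have hp := parallelogram_law_with_norm ℝ (y - x) (z - y)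
    have e4 : phi d τ y (y + y - z) = phi d τ y z := by
      simp only [phi, e1, norm_neg]
    have e5 : g z + g (y + y - z) = phi d τ y z * (‖y - x‖ ^ 2 / τ) := by
      simp only [hg, e4]
      rw [e1, e2, e3, norm_neg]
      field_simp
      linear_combination phi d τ y z * hp
    have := phi_pos d hτ y z
    change 0 ≤ g z + g (y + y - z)
    rw [e5]
    positivity
  rw [integral_add hint (hint.comp_sub_left (y + y)), hrefl] at hsum
  linarith

theorem stmt13 (d : ℕ) (τ : ℝ) (hτ : 0 < τ)
    (f : EuclideanSpace ℝ (Fin d) → ℝ) (hf : Measurable f) (hfb : ∃ C, ∀ y, C ≤ f y)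
    (hZint : ∀ y, Integrable (fun x' => Real.exp (-f x') * phi d τ y x'))
    (hZpos : ∀ y, 0 < Z d τ f y)
    (K : ℕ) (x : ℕ → EuclideanSpace ℝ (Fin d))
    (hmin : ∀ k < K, ∀ y, KL d (phi d τ (x (k + 1))) (qdens d τ f (x k)) ≤
      KL d (phi d τ y) (qdens d τ f (x k)))
    (hKLfin : ∀ k < K, ∀ y, Integrable
      (fun z => phi d τ y z * Real.log (phi d τ y z / qdens d τ f (x k) z)))
    (hef : ∀ k < K, Integrable (fun z => Real.exp (f z) * qdens d τ f (x k) z))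
    (hFH : ∀ y, Integrable (fun z => f z * phi d τ y z)) :
    ∀ k, 1 ≤ k → k ≤ K →
      (∫ z, f z * phi d τ (x k) z) ≤ ∫ z, f z * phi d τ (x (k - 1)) z := by
  intro k hk1 hkK
  obtain ⟨j, rfl⟩ : ∃ j, k = j + 1 := ⟨k - 1, by omega⟩
  have hj : j < K := by omega
  rw [Nat.add_sub_cancel]
  have hlin (y : EuclideanSpace ℝ (Fin d)) : Integrable fun z =>
      f z * phi d τ y z + Real.log (Z d τ f (x j)) * phi d τ y z :=
    (hFH y).add ((integrable_phi d hτ y).const_mul _)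
  have hquad (y : EuclideanSpace ℝ (Fin d)) : Integrable fun z =>
      phi d τ y z * ((‖z - x j‖ ^ 2 - ‖z - y‖ ^ 2) / (2 * τ)) := by
    refine ((hKLfin j hj y).sub (hlin y)).congr (Filter.Eventually.of_forall fun z => ?_)
    simp only [Pi.sub_apply]
    rw [phi_mul_log_div_qdens d hτ f (x j) y z (hZpos _)]
    ring
  have hKL (y : EuclideanSpace ℝ (Fin d)) : KL d (phi d τ y) (qdens d τ f (x j)) =
      (∫ z, f z * phi d τ y z) + Real.log (Z d τ f (x j)) * (∫ z, phi d τ y z) +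
        ∫ z, phi d τ y z * ((‖z - x j‖ ^ 2 - ‖z - y‖ ^ 2) / (2 * τ)) := by
    unfold KL
    simp_rw [fun z => phi_mul_log_div_qdens d hτ f (x j) y z (hZpos _)]
    rw [integral_add (hlin y) (hquad y),
      integral_add (hFH y) ((integrable_phi d hτ y).const_mul _), integral_const_mul]
  have hle := hmin j hj (x j)
  have hnonneg := integral_phi_mul_sq_sub_sq_nonneg d hτ (x j) (x (j + 1)) (hquad _)
  rw [hKL, hKL, integral_phi_eq d τ (x (j + 1)) (x j)] at hle
  simp only [sub_self, zero_div, mul_zero, integral_zero, add_zero] at hle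
  linarith
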